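/- arXiv:2403.05604 — 13 statements merged into one kernel-verified Lean document; each statement's English description precedes it below -/
import Mathlib

section
/- Let F be a finite poset such that (i) F has at least two minimal elements, and (ii) every maximal element of F has a lower cover in F which is not a minimal element of F. Then two colours suffice for F: for every finite poset P with at least two elements there exists a colouring of the elements of P with 2 colours such that every maximal F-free subset of P having at least two elements gets both colours. -/
/-- `S` (a subset of the poset `P`) contains a copy of the poset `F`,
i.e. there is an order embedding of `F` into `P` whose range lies in `S`. -/
def ContainsCopy (F : Type*) [PartialOrder F] {P : Type*} [PartialOrder P] (S : Set P) : Prop :=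
  ∃ f : F ↪o P, Set.range f ⊆ S

/-- `S` is an `F`-free subset of the poset `P`. -/
def IsFreeOf (F : Type*) [PartialOrder F] {P : Type*} [PartialOrder P] (S : Set P) : Prop :=
  ¬ ContainsCopy F S

/-- `S` is a maximal `F`-free subset of the poset `P`: `S` is `F`-free and no subset of `P`
strictly containing `S` is `F`-free. -/
def IsMaxFreeOf (F : Type*) [PartialOrder F] {P : Type*} [PartialOrder P] (S : Set P) : Prop :=
  IsFreeOf F S ∧ ∀ T : Set P, S ⊂ T → ¬ IsFreeOf F T

theorem use_new {F : Type*} [PartialOrder F] {P : Type*} [PartialOrder P] {S : Set P}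
    (h : IsMaxFreeOf F S) {q : P} (hq : q ∉ S) :
    ∃ (f : F ↪o P) (m : F), f m = q ∧ ∀ x, f x = q ∨ f x ∈ S := by
  have h2 := h.2 (insert q S) (Set.ssubset_insert hq)
  unfold IsFreeOf at h2
  rw [not_not] at h2
  obtain ⟨f, hf⟩ := h2
  have hall : ∀ x, f x = q ∨ f x ∈ S := fun x => hf ⟨x, rfl⟩
  by_cases hm : ∃ m, f m = q
  · obtain ⟨m, hm⟩ := hm
    exact ⟨f, m, hm, hall⟩
  · push Not at hm
    refine absurd ⟨f, ?_⟩ h.1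
    rintro _ ⟨x, rfl⟩
    exact (hall x).resolve_left (hm x)

/-- If the finite poset `F` has at least two minimal elements and every maximal element of `F`
has a lower cover which is not minimal, then every finite poset `P` with at least two elements
admits a 2-colouring such that every maximal `F`-free subset of `P` with at least two elements
gets both colours. -/
theorem two_colours_suffice (F : Type*) [PartialOrder F] [Fintype F]
    (hmin : ∃ a b : F, IsMin a ∧ IsMin b ∧ a ≠ b)
    (hcov : ∀ x : F, IsMax x → ∃ y : F, y ⋖ x ∧ ¬ IsMin y)
    (P : Type*) [PartialOrder P] [Fintype P] (hP : 1 < Fintype.card P) :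
    ∃ c : P → Fin 2, ∀ S : Set P, IsMaxFreeOf F S → S.Nontrivial →
      ∃ x ∈ S, ∃ y ∈ S, c x ≠ c y := by
  classical
  by_cases hne : ∃ p : P, ¬ IsMin p
  · obtain ⟨p, hp⟩ := (Set.toFinite {p : P | ¬ IsMin p}).exists_minimal hne
    obtain ⟨q, hqp⟩ := not_isMin_iff.1 hp.prop
    refine ⟨fun x => if p ≤ x then 0 else 1, fun S hS hnt => ?_⟩
    by_contra hcon
    push Not at hcon
    obtain ⟨s, hs⟩ := hnt.nonempty
    by_cases hps : p ≤ s
    · have hall : ∀ x ∈ S, p ≤ x := by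
        intro x hx
        by_contra hx'
        have := hcon s hs x hx
        simp [hps, hx'] at this
      obtain ⟨f, m, hm, hf⟩ := use_new hS (fun h => (hall q h).not_gt hqp)
      have hbot : ∀ x, m ≤ x := by
        intro x
        rw [← f.le_iff_le, hm]
        rcases hf x with h | h
        · exact h.ge
        · exact hqp.le.trans (hall _ h)
      obtain ⟨a, b, ha, hb, hab⟩ := hmin
      exact hab ((ha.eq_of_le (hbot a)).symm.trans (hb.eq_of_le (hbot b)))
    · have hall : ∀ x ∈ S, ¬ p ≤ x := by
        intro x hx hx'
        have := hcon s hs x hx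
        simp [hps, hx'] at this
      obtain ⟨f, m, hm, hf⟩ := use_new hS (fun h => hall p h le_rfl)
      have hmax : IsMax m := by
        intro x hx
        rw [← f.le_iff_le] at hx ⊢
        rcases hf x with h | h
        · rw [h, hm]
        · exact absurd (hm ▸ hx) (hall _ h)
      obtain ⟨y, hy, hymin⟩ := hcov m hmax
      obtain ⟨z, hz⟩ := not_isMin_iff.1 hymin
      have h1 : f y < p := hm ▸ f.lt_iff_lt.2 hy.lt
      have h2 : f z < f y := f.lt_iff_lt.2 hz
      exact h1.not_ge (hp.le_of_le (not_isMin_iff.2 ⟨_, h2⟩) h1.le)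
  · push Not at hne
    obtain ⟨u, v, huv⟩ := Fintype.exists_pair_of_one_lt_card hP
    refine ⟨fun x => if x = u then 0 else 1, fun S hS hnt => ?_⟩
    have hall : ∀ x, x ∈ S := by
      intro x
      by_contra hx
      obtain ⟨f, m, hm, hf⟩ := use_new hS hx
      obtain ⟨t, -, ht⟩ := (Set.toFinite (Set.univ : Set F)).exists_le_maximal (Set.mem_univ m)
      obtain ⟨y, hy, -⟩ := hcov t (fun w hw => ht.le_of_ge (Set.mem_univ w) hw)
      have h1 : f y < f t := f.lt_iff_lt.2 hy.lt
      exact (hne (f t)).not_lt h1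
    exact ⟨u, hall u, v, hall v, by simp [huv.symm]⟩
end

section
/- Let F be a finite poset such that (i) F has at least two maximal elements, and (ii) every minimal element of F has an upper cover in F which is not a maximal element of F. Then two colours suffice for F: for every finite poset P with at least two elements there exists a colouring of the elements of P with 2 colours such that every maximal F-free subset of P having at least two elements gets both colours. -/
theorem maxFree_insert {F : Type*} [PartialOrder F] {P : Type*} [PartialOrder P] {S : Set P}
    (hS : IsMaxFreeOf F S) {p : P} (hp : p ∉ S) :
    ∃ f : F ↪o P, (∃ w, f w = p) ∧ ∀ u, f u = p ∨ f u ∈ S := by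
  have h := hS.2 (insert p S) (Set.ssubset_insert hp)
  unfold IsFreeOf at h
  rw [not_not] at h
  obtain ⟨f, hf⟩ := h
  have hf' : ∀ u, f u = p ∨ f u ∈ S := fun u => hf ⟨u, rfl⟩
  refine ⟨f, ?_, hf'⟩
  by_contra hne
  apply hS.1
  refine ⟨f, ?_⟩
  rintro _ ⟨u, rfl⟩
  exact (hf' u).resolve_left fun h => hne ⟨u, h⟩

/-- If the finite poset `F` has at least two maximal elements and every minimal element of `F`
has an upper cover which is not maximal, then every finite poset `P` with at least two elements
admits a 2-colouring such that every maximal `F`-free subset of `P` with at least two elements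
gets both colours. -/
theorem two_colours_suffice_dual (F : Type*) [PartialOrder F] [Fintype F]
    (hmax : ∃ a b : F, IsMax a ∧ IsMax b ∧ a ≠ b)
    (hcov : ∀ x : F, IsMin x → ∃ y : F, x ⋖ y ∧ ¬ IsMax y)
    (P : Type*) [PartialOrder P] [Fintype P] (hP : 1 < Fintype.card P) :
    ∃ c : P → Fin 2, ∀ S : Set P, IsMaxFreeOf F S → S.Nontrivial →
      ∃ x ∈ S, ∃ y ∈ S, c x ≠ c y := by
  classical
  by_cases hanti : ∀ p : P, IsMax p
  · obtain ⟨p, q, hpq⟩ := Fintype.exists_pair_of_one_lt_card hP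
    refine ⟨fun r => if r = p then 0 else 1, fun S hS _ => ?_⟩
    have hall : ∀ r, r ∈ S := by
      intro r
      by_contra hr
      obtain ⟨f, -, -⟩ := maxFree_insert hS hr
      obtain ⟨a, -, -⟩ := hmax
      obtain ⟨x, -, hx⟩ := Finite.exists_le_minimal (p := fun _ : F => True) (a := a) trivial
      obtain ⟨y, hy, -⟩ := hcov x (minimal_true.1 hx)
      exact (hanti (f x)).not_lt (f.lt_iff_lt.2 hy.lt)
    refine ⟨p, hall p, q, hall q, ?_⟩
    simp [hpq.symm]
  · push Not at hanti
    obtain ⟨q0, hq0⟩ := hanti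
    obtain ⟨q, -, hq⟩ := Finite.exists_le_maximal (p := fun r : P => ¬ IsMax r) hq0
    obtain ⟨b, hb⟩ := not_isMax_iff.1 hq.prop
    refine ⟨fun r => if r < b then 0 else 1, fun S hS hnt => ?_⟩
    by_contra hmono
    push Not at hmono
    by_cases hlow : ∃ s ∈ S, s < b
    · obtain ⟨s, hs, hsb⟩ := hlow
      have hall : ∀ r ∈ S, r < b := by
        intro r hr
        by_contra hrb
        have := hmono s hs r hr
        simp [hsb, hrb] at this
      obtain ⟨f, ⟨w, hw⟩, hf⟩ := maxFree_insert hS (p := b) fun h => lt_irrefl _ (hall b h)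
      have htop : ∀ u, u ≤ w := by
        intro u
        rw [← f.le_iff_le, hw]
        rcases hf u with h | h
        · exact h.le
        · exact (hall _ h).le
      obtain ⟨a, a', ha, ha', hne⟩ := hmax
      exact hne ((ha.eq_of_le (htop a)).trans (ha'.eq_of_le (htop a')).symm)
    · push Not at hlow
      obtain ⟨f, ⟨x, hx⟩, hf⟩ := maxFree_insert hS (p := q) fun h => hlow q h hb
      have hxmin : IsMin x := by
        rw [isMin_iff_forall_not_lt]
        intro u hu
        have hlt : f u < q := hx ▸ f.lt_iff_lt.2 hu
        rcases hf u with h | h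
        · exact hlt.ne h
        · exact hlow _ h (hlt.trans hb)
      obtain ⟨y, hxy, hy⟩ := hcov x hxmin
      obtain ⟨z, hz⟩ := not_isMax_iff.1 hy
      have h1 : q < f y := hx ▸ f.lt_iff_lt.2 hxy.lt
      have h2 : f y < f z := f.lt_iff_lt.2 hz
      exact hq.not_prop_of_gt h1 (not_isMax_iff.2 ⟨_, h2⟩)
end

section
/- Let F be a finite poset with at least two elements which is nonbounded (that is, F does not have both a minimum element and a maximum element) and which has no isolated elements (every element of F is comparable to some other element of F). Then three colours suffice for F: for every finite poset P with at least two elements there exists a colouring of the elements of P with 3 colours such that every maximal F-free subset of P having at least two elements gets at least two colours. -/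
theorem exists_copy_through {F : Type*} [PartialOrder F] {P : Type*} [PartialOrder P]
    {S : Set P} (hS : IsMaxFreeOf F S) {x : P} (hx : x ∉ S) :
    ∃ f : F ↪o P, ∃ a, f a = x ∧ ∀ b, b ≠ a → f b ∈ S := by
  have h := hS.2 (insert x S) (Set.ssubset_insert hx)
  obtain ⟨f, hf⟩ := not_not.mp h
  by_cases ha : ∃ a, f a = x
  · obtain ⟨a, ha⟩ := ha
    refine ⟨f, a, ha, fun b hb => ?_⟩
    rcases hf ⟨b, rfl⟩ with h1 | h1
    · exact absurd (f.injective (h1.trans ha.symm)) hb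
    · exact h1
  · refine absurd ⟨f, ?_⟩ hS.1
    rintro _ ⟨b, rfl⟩
    rcases hf ⟨b, rfl⟩ with h1 | h1
    · exact absurd ⟨b, h1⟩ ha
    · exact h1

theorem colour_of_point {F : Type*} [PartialOrder F]
    (hnoiso : ∀ x : F, ∃ y : F, y ≠ x ∧ (x ≤ y ∨ y ≤ x))
    {P : Type*} [PartialOrder P] (x : P)
    (hx : ∀ (f : F ↪o P) (a : F), f a = x → ∃ b, b ≠ a ∧ ¬ (f b ≤ x ∨ x ≤ f b)) :
    ∃ c : P → Fin 3, ∀ S : Set P, IsMaxFreeOf F S → S.Nontrivial →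
      ∃ x ∈ S, ∃ y ∈ S, c x ≠ c y := by
  classical
  refine ⟨fun p => if p = x then 0 else if p ≤ x ∨ x ≤ p then 1 else 2, fun S hS hn => ?_⟩
  by_cases hxS : x ∈ S
  · obtain ⟨y, hy, hyx⟩ := hn.exists_ne x
    refine ⟨x, hxS, y, hy, ?_⟩
    simp only [if_true, if_neg hyx]
    split_ifs <;> decide
  · obtain ⟨f, a, ha, hf⟩ := exists_copy_through hS hxS
    obtain ⟨b, hb, hbx⟩ := hx f a ha
    obtain ⟨d, hd, hdx⟩ := hnoiso a
    refine ⟨f b, hf b hb, f d, hf d hd, ?_⟩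
    have h1 : f b ≠ x := fun h => hbx (Or.inl h.le)
    have h2 : f d ≠ x := fun h => hd (f.injective (h.trans ha.symm))
    have h3 : f d ≤ x ∨ x ≤ f d := by
      rw [← ha, f.le_iff_le, f.le_iff_le]; exact hdx.symm
    simp only [if_neg h1, if_neg h2, if_pos h3, if_neg hbx]
    decide

/-- Sands–Shen: if the finite poset `F` (with at least two elements) is nonbounded (it does not
have both a minimum and a maximum element) and has no isolated elements, then every finite poset
`P` with at least two elements admits a 3-colouring such that every maximal `F`-free subset of
`P` with at least two elements gets at least two colours. -/
theorem three_colours_suffice (F : Type*) [PartialOrder F] [Fintype F]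
    (hF : 1 < Fintype.card F)
    (hnonbounded : ¬ ((∃ m : F, ∀ x : F, m ≤ x) ∧ (∃ M : F, ∀ x : F, x ≤ M)))
    (hnoiso : ∀ x : F, ∃ y : F, y ≠ x ∧ (x ≤ y ∨ y ≤ x))
    (P : Type*) [PartialOrder P] [Fintype P] (hP : 1 < Fintype.card P) :
    ∃ c : P → Fin 3, ∀ S : Set P, IsMaxFreeOf F S → S.Nontrivial →
      ∃ x ∈ S, ∃ y ∈ S, c x ≠ c y := by
  have : Nonempty P := Fintype.card_pos_iff.mp (by omega)
  rcases not_and_or.mp hnonbounded with h | h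
  · obtain ⟨x, hx⟩ := (Set.finite_univ (α := P)).exists_minimal Set.univ_nonempty
    refine colour_of_point hnoiso x fun f a ha => ?_
    push Not at h
    obtain ⟨b, hb⟩ := h a
    refine ⟨b, fun e => hb e.ge, ?_⟩
    have h1 : ¬ x ≤ f b := by rw [← ha, f.le_iff_le]; exact hb
    rintro (h2 | h2)
    · exact h1 (hx.2 trivial h2)
    · exact h1 h2
  · obtain ⟨x, hx⟩ := (Set.finite_univ (α := P)).exists_maximal Set.univ_nonempty
    refine colour_of_point hnoiso x fun f a ha => ?_
    push Not at h
    obtain ⟨b, hb⟩ := h a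
    refine ⟨b, fun e => hb e.le, ?_⟩
    have h1 : ¬ f b ≤ x := by rw [← ha, f.le_iff_le]; exact hb
    rintro (h2 | h2)
    · exact h1 h2
    · exact h1 (hx.2 trivial h2)
end

section
/- Let F be a finite bounded poset (F has a minimum element and a maximum element) with at least two elements and with no interior splitting elements, i.e., no element of F other than the minimum and the maximum is comparable to every element of F. Then ten colours suffice for F: for every finite poset P with at least two elements there exists a colouring of the elements of P with 10 colours such that every maximal F-free subset of P having at least two elements gets at least two colours. -/
theorem aux_copy {F : Type*} [PartialOrder F] {P : Type*} [PartialOrder P] {S : Set P}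
    (hS : IsMaxFreeOf F S) {w : P} (hw : w ∉ S) :
    ∃ f : F ↪o P, ∃ a : F, f a = w ∧ ∀ y, y ≠ a → f y ∈ S := by
  have h := hS.2 (insert w S) (Set.ssubset_insert hw)
  unfold IsFreeOf at h
  rw [not_not] at h
  obtain ⟨f, hf⟩ := h
  have hf' : ∀ y, f y = w ∨ f y ∈ S := fun y => hf ⟨y, rfl⟩
  by_cases ha : ∃ a, f a = w
  · obtain ⟨a, ha⟩ := ha
    refine ⟨f, a, ha, fun y hy => ?_⟩
    rcases hf' y with h | h
    · exact absurd (f.injective (h.trans ha.symm)) hy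
    · exact h
  · push Not at ha
    exfalso
    refine hS.1 ⟨f, ?_⟩
    rintro _ ⟨y, rfl⟩
    exact (hf' y).resolve_left (ha y)

theorem aux_cone {F : Type*} [PartialOrder F] [Fintype F] (hF : 1 < Fintype.card F)
    (hb : ∃ m : F, ∀ x : F, m ≤ x) {P : Type*} [PartialOrder P] {S : Set P}
    (hS : IsMaxFreeOf F S) {w : P} (hw : w ∉ S)
    (h : ∀ s ∈ S, ¬ s < w ∧ ¬ w < s) : False := by
  obtain ⟨f, a, ha, hf⟩ := aux_copy hS hw
  obtain ⟨m, hm⟩ := hb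
  by_cases ham : a = m
  · haveI := Fintype.one_lt_card_iff_nontrivial.1 hF
    obtain ⟨b, hb⟩ := exists_ne a
    refine (h (f b) (hf b hb)).2 ?_
    rw [← ha]
    exact f.lt_iff_lt.2 (lt_of_le_of_ne (ham ▸ hm b) hb.symm)
  · refine (h (f m) (hf m (Ne.symm ham))).1 ?_
    rw [← ha]
    exact f.lt_iff_lt.2 (lt_of_le_of_ne (hm a) (Ne.symm ham))

theorem aux_gap {F : Type*} [PartialOrder F]
    (hnosplit : ∀ x : F, (∀ y : F, x ≤ y ∨ y ≤ x) → IsBot x ∨ IsTop x)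
    {P : Type*} [PartialOrder P] {S : Set P}
    (hS : IsMaxFreeOf F S) {w : P} (hw : w ∉ S)
    (h : ∀ s ∈ S, s < w ∨ w < s) {x y : P} (hx : x ∈ S) (hy : y ∈ S)
    (hxw : x < w) (hwy : w < y) : False := by
  classical
  obtain ⟨f, a, ha, hf⟩ := aux_copy hS hw
  have hs : IsBot a ∨ IsTop a := by
    apply hnosplit
    intro z
    by_cases hz : z = a
    · exact Or.inl hz.ge
    · rcases h _ (hf z hz) with h1 | h1
      · rw [← ha] at h1
        exact Or.inr (f.lt_iff_lt.1 h1).le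
      · rw [← ha] at h1
        exact Or.inl (f.lt_iff_lt.1 h1).le
  rcases hs with hs | hs
  · have key : ∀ z, z ≠ a → x < f z := fun z hz =>
      hxw.trans (ha ▸ f.lt_iff_lt.2 (lt_of_le_of_ne (hs z) hz.symm))
    refine hS.1 ⟨OrderEmbedding.ofMapLEIff (fun z => if z = a then x else f z) ?_, ?_⟩
    · intro u v
      by_cases hu : u = a <;> by_cases hv : v = a
      · simp [hu, hv]
      · simp [hu, hv, (key v hv).le, hs v]
      · simp only [hu, hv, if_true, if_false]
        constructor
        · intro h1; exact absurd h1 (key u hu).not_ge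
        · intro h1; exact absurd (le_antisymm h1 (hs u)) hu
      · simp [hu, hv]
    · rintro _ ⟨z, rfl⟩
      by_cases hz : z = a
      · simpa [hz] using hx
      · simpa [hz] using hf z hz
  · have key : ∀ z, z ≠ a → f z < y := fun z hz =>
      lt_trans (ha ▸ f.lt_iff_lt.2 (lt_of_le_of_ne (hs z) hz)) hwy
    refine hS.1 ⟨OrderEmbedding.ofMapLEIff (fun z => if z = a then y else f z) ?_, ?_⟩
    · intro u v
      by_cases hu : u = a <;> by_cases hv : v = a
      · simp [hu, hv]
      · simp only [hu, hv, if_true, if_false]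
        constructor
        · intro h1; exact absurd h1 (key v hv).not_ge
        · intro h1; exact absurd (le_antisymm (hs v) h1) hv
      · simp [hu, hv, (key u hu).le, hs u]
      · simp [hu, hv]
    · rintro _ ⟨z, rfl⟩
      by_cases hz : z = a
      · simpa [hz] using hy
      · simpa [hz] using hf z hz

theorem aux_initial {n : ℕ} (Q : Fin n → Prop) (hQ : ∀ i j, i ≤ j → Q j → Q i) :
    ∃ m, m ≤ n ∧ ∀ i : Fin n, Q i ↔ i.val < m := by
  classical
  have hex : ∃ m, ∀ i : Fin n, m ≤ i.val → ¬ Q i := ⟨n, fun i h => by omega⟩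
  refine ⟨Nat.find hex, Nat.find_min' hex (fun i h => by omega), fun i => ?_⟩
  constructor
  · intro h
    by_contra h1
    exact Nat.find_spec hex i (by omega) h
  · intro h
    have := Nat.find_min hex h
    push Not at this
    obtain ⟨j, h1, h2⟩ := this
    exact hQ i j h1 h2

/-- Coordinates relative to a maximal chain. -/
theorem aux_coord (P : Type*) [PartialOrder P] [Fintype P] :
    ∃ (n : ℕ) (e : Fin n → P) (p q : P → ℕ),
      (∀ x, p x < q x) ∧ (∀ x, q x ≤ n) ∧
      (∀ i x, e i < x ↔ i.val < p x) ∧ (∀ i x, x < e i ↔ q x ≤ i.val) ∧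
      (∀ i, p (e i) = i.val) ∧ (∀ i, q (e i) = i.val + 1) ∧
      (∀ x y, x < y → p x ≤ p y) ∧ (∀ x y, x < y → q x ≤ q y) := by
  classical
  obtain ⟨C⟩ : Nonempty (Flag P) := inferInstance
  let E := monoEquivOfFin C (rfl : Fintype.card C = _)
  set n := Fintype.card C with hn
  let e : Fin n → P := fun i => (E i : P)
  have elt : ∀ i j, e i < e j ↔ i < j := fun i j => by
    change (E i : P) < E j ↔ _
    rw [Subtype.coe_lt_coe, E.lt_iff_lt]
  have ele : ∀ i j, i ≤ j → e i ≤ e j := fun i j h => by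
    change (E i : P) ≤ E j
    rw [Subtype.coe_le_coe]; exact E.monotone h
  choose p hp1 hp2 using fun x : P => aux_initial (fun i => e i < x)
    (fun i j hij h => lt_of_le_of_lt (ele i j hij) h)
  choose q hq1 hq2 using fun x : P => aux_initial (fun i => ¬ x < e i)
    (fun i j hij h h1 => h (lt_of_lt_of_le h1 (ele i j hij)))
  have hq2' : ∀ i x, x < e i ↔ q x ≤ i.val := fun i x => by
    have := hq2 x i
    rw [not_iff_comm] at this
    rw [← this]; omega
  have pe : ∀ i, p (e i) = i.val := by
    intro i
    have h1 := hp1 (e i)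
    have h2 : ∀ j : Fin n, j < i ↔ j.val < p (e i) := fun j => by rw [← hp2, elt]
    rcases lt_trichotomy (p (e i)) i.val with h | h | h
    · have := (h2 ⟨p (e i), by omega⟩).1 h
      simp at this
    · exact h
    · have := (h2 i).2 h
      simp at this
  have qe : ∀ i, q (e i) = i.val + 1 := by
    intro i
    have h1 := hq1 (e i)
    have h2 : ∀ j : Fin n, i < j ↔ q (e i) ≤ j.val := fun j => by rw [← hq2', elt]
    have h3 : i.val < q (e i) := by
      by_contra h
      have := (h2 i).2 (by omega)
      simp at this
    by_contra h
    have hlt : i.val + 1 < n := by omega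
    have := (h2 ⟨i.val + 1, hlt⟩).1 (Fin.lt_def.2 (by simp))
    simp at this
    omega
  refine ⟨n, e, p, q, ?_, hq1, fun i x => hp2 x i, hq2', pe, qe, ?_, ?_⟩
  · intro x
    by_contra h
    have hmem : x ∈ C := by
      rw [Flag.mem_iff_forall_le_or_ge]
      intro b hb
      obtain ⟨i, hi⟩ := E.surjective ⟨b, hb⟩
      have hib : e i = b := by change (E i : P) = b; rw [hi]
      rw [← hib]
      by_cases h1 : i.val < p x
      · exact Or.inr ((hp2 x i).2 h1).le
      · exact Or.inl ((hq2' i x).2 (by omega)).le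
    obtain ⟨i, hi⟩ := E.surjective ⟨x, hmem⟩
    have hib : e i = x := by change (E i : P) = x; rw [hi]
    have := pe i
    have := qe i
    rw [hib] at *
    omega
  · intro x y hxy
    by_contra h
    have h1 := hp1 x
    have h2 : e ⟨p y, by omega⟩ < x := (hp2 x _).2 (by simp; omega)
    have := (hp2 y _).1 (h2.trans hxy)
    simp at this
  · intro x y hxy
    by_contra h
    have h1 := hq1 x
    have h2 : y < e ⟨q y, by omega⟩ := (hq2' _ y).2 (by simp)
    have := (hq2' _ x).1 (hxy.trans h2)
    simp at this
    omega

/-- Greedy blocks. -/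
theorem aux_blocks {P : Type*} [Fintype P] (p q : P → ℕ) :
    ∃ R : ℕ → ℕ, R 0 = 0 ∧ (∀ k, R k < R (k+1)) ∧
      (∀ k x, p x ≤ R k → q x ≤ R (k+1)) ∧
      (∀ k, R (k+1) = R k + 1 ∨ ∃ x, p x ≤ R k ∧ q x = R (k+1)) := by
  classical
  let g : ℕ → ℕ := fun r => max (r + 1) ((Finset.univ.filter (fun x => p x ≤ r)).sup q)
  let R : ℕ → ℕ := fun k => g^[k] 0
  have hR : ∀ k, R (k+1) = g (R k) := fun k => Function.iterate_succ_apply' g k 0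
  refine ⟨R, rfl, fun k => ?_, fun k x hx => ?_, fun k => ?_⟩
  · rw [hR]
    have : R k + 1 ≤ g (R k) := le_max_left _ _
    omega
  · rw [hR]
    refine le_trans ?_ (le_max_right _ _)
    exact Finset.le_sup (f := q) (by simpa using hx)
  · rw [hR]
    rcases le_total ((Finset.univ.filter (fun x => p x ≤ R k)).sup q) (R k + 1) with h | h
    · left; exact max_eq_left h
    · right
      have he : g (R k) = _ := max_eq_right h
      rw [he]
      have hne : (Finset.univ.filter (fun x => p x ≤ R k)).Nonempty := by
        by_contra h1
        rw [Finset.not_nonempty_iff_eq_empty] at h1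
        rw [h1] at h
        simp at h
      obtain ⟨x, hx, hx2⟩ := Finset.exists_mem_eq_sup _ hne q
      exact ⟨x, by simpa using hx, hx2.symm⟩

theorem ten_colours_suffice (F : Type*) [PartialOrder F] [Fintype F]
    (hF : 1 < Fintype.card F)
    (hbounded : (∃ m : F, ∀ x : F, m ≤ x) ∧ (∃ M : F, ∀ x : F, x ≤ M))
    (hnosplit : ∀ x : F, (∀ y : F, x ≤ y ∨ y ≤ x) → IsBot x ∨ IsTop x)
    (P : Type*) [PartialOrder P] [Fintype P] (hP : 1 < Fintype.card P) :
    ∃ c : P → Fin 10, ∀ S : Set P, IsMaxFreeOf F S → S.Nontrivial →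
      ∃ x ∈ S, ∃ y ∈ S, c x ≠ c y := by
  classical
  obtain ⟨n, e, p, q, hpq, hqn, hep, heq, pe, qe, pm, qm⟩ := aux_coord P
  obtain ⟨R, R0, Rlt, Rq, Rx⟩ := aux_blocks p q
  have Rmono : StrictMono R := strictMono_nat_of_lt_succ Rlt
  have hbex : ∀ i, ∃ k, R k ≤ i ∧ i < R (k+1) := by
    intro i
    induction i with
    | zero => exact ⟨0, by omega, by have := Rlt 0; omega⟩
    | succ i ih =>
      obtain ⟨k, h1, h2⟩ := ih
      by_cases h : i + 1 < R (k+1)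
      · exact ⟨k, by omega, h⟩
      · exact ⟨k+1, by omega, by have := Rlt (k+1); omega⟩
  choose b hb1 hb2 using fun x : P => hbex (p x)
  have hbq : ∀ x, q x ≤ R (b x + 2) := fun x => Rq (b x + 1) x (hb2 x).le
  have hbu : ∀ x k, R k ≤ p x → p x < R (k+1) → b x = k := by
    intro x k h1 h2
    have h3 := Rmono.lt_iff_lt.1 (lt_of_le_of_lt h1 (hb2 x))
    have h4 := Rmono.lt_iff_lt.1 (lt_of_le_of_lt (hb1 x) h2)
    omega
  let col : P → ℕ := fun x =>
    if R (b x + 1) < q x then b x % 3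
    else if x ∈ Set.range e then 7 + b x % 2
    else if q x = R (b x + 1) then 3 + b x % 2
    else if p x = R (b x) then 5 + b x % 2
    else 7 + b x % 2
  have hcol : ∀ x,
      (R (b x + 1) < q x ∧ x ∉ Set.range e ∧ col x = b x % 3) ∨
      (q x = R (b x + 1) ∧ x ∉ Set.range e ∧ col x = 3 + b x % 2) ∨
      (q x ≤ R (b x + 1) ∧ p x = R (b x) ∧ x ∉ Set.range e ∧ col x = 5 + b x % 2) ∨
      (q x ≤ R (b x + 1) ∧ (x ∈ Set.range e ∨ (q x < R (b x + 1) ∧ R (b x) < p x)) ∧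
        col x = 7 + b x % 2) := by
    intro x
    have h1 := hb1 x
    have h2 := hb2 x
    by_cases c1 : R (b x + 1) < q x
    · left
      refine ⟨c1, ?_, by simp [col, c1]⟩
      rintro ⟨i, rfl⟩
      have := pe i
      have := qe i
      omega
    by_cases c2 : x ∈ Set.range e
    · right; right; right
      exact ⟨by omega, Or.inl c2, by simp only [col]; rw [if_neg c1, if_pos c2]⟩
    by_cases c3 : q x = R (b x + 1)
    · right; left
      exact ⟨c3, c2, by simp only [col]; rw [if_neg c1, if_neg c2, if_pos c3]⟩
    by_cases c4 : p x = R (b x)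
    · right; right; left
      exact ⟨by omega, c4, c2, by simp only [col]; rw [if_neg c1, if_neg c2, if_neg c3, if_pos c4]⟩
    · right; right; right
      exact ⟨by omega, Or.inr ⟨by omega, by omega⟩,
        by simp only [col]; rw [if_neg c1, if_neg c2, if_neg c3, if_neg c4]⟩
  have hcole : ∀ i, col (e i) = 7 + b (e i) % 2 := by
    intro i
    have hm : e i ∈ Set.range e := ⟨i, rfl⟩
    rcases hcol (e i) with h | h | h | h
    · exact absurd hm h.2.1
    · exact absurd hm h.2.1
    · exact absurd hm h.2.2.1
    · exact h.2.2
  have hlt10 : ∀ x, col x < 10 := by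
    intro x
    rcases hcol x with h | h | h | h <;> omega
  refine ⟨fun x => ⟨col x, hlt10 x⟩, fun S hS hnt => ?_⟩
  by_contra hcon
  push Not at hcon
  have hmono : ∀ x ∈ S, ∀ y ∈ S, col x = col y := fun x hx y hy => by
    have := hcon x hx y hy
    simpa using this
  -- gap blocks
  have hgap : ∀ g : ℕ, ∀ x ∈ S, ∀ y ∈ S, q x ≤ R g → g < b y →
      (col x ≠ 7 + g % 2) → (∀ s ∈ S, q s ≤ R g ∨ g < b s) → False := by
    intro g x hx y hy hxg hgy hc hall
    have h1 : R g < R (b y) := Rmono hgy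
    have h2 := hb1 y
    have h3 := hpq y
    have h4 := hqn y
    have hgn : R g < n := by omega
    let w := e ⟨R g, hgn⟩
    have pw : p w = R g := pe _
    have bw : b w = g := hbu w g (by omega) (by have := Rlt g; omega)
    have hwS : w ∉ S := by
      intro hw
      have := hmono x hx w hw
      have h5 : col w = 7 + b w % 2 := hcole _
      rw [bw] at h5
      omega
    have hl : ∀ s, q s ≤ R g → s < w := fun s h => (heq _ s).2 h
    have hr : ∀ s, g < b s → w < s := fun s h => (hep _ s).2 (by
      have := Rmono h
      have := hb1 s
      simp; omega)
    exact aux_gap hnosplit hS hwS (fun s hs => (hall s hs).imp (hl s) (hr s)) hx hy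
      (hl x hxg) (hr y hgy)
  have hlocal' : ∀ x ∈ S, ∀ y ∈ S, ¬ b x < b y := by
    intro x hx y hy hlt
    have cxy := hmono x hx y hy
    rcases hcol x with h | h
    · have hy' : col y = b y % 3 := by
        rcases hcol y with h' | h' | h' | h' <;> omega
      refine hgap (b x + 2) x hx y hy (hbq x) (by omega) (by omega) ?_
      intro s hs
      have cs := hmono x hx s hs
      have hs' : col s = b s % 3 := by
        rcases hcol s with h' | h' | h' | h' <;> omega
      by_cases hbs : b s ≤ b x
      · left
        exact (hbq s).trans (Rmono.monotone (by omega))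
      · right; omega
    · have key : ∀ s ∈ S, q s ≤ R (b s + 1) ∧ b s % 2 = b x % 2 := by
        intro s hs
        have cs := hmono x hx s hs
        rcases hcol s with h' | h' | h' | h' <;> rcases h with h | h | h <;> omega
      refine hgap (b x + 1) x hx y hy (key x hx).1 ?_ ?_ ?_
      · have := key y hy; omega
      · rcases h with h | h | h <;> omega
      · intro s hs
        have := key s hs
        by_cases hbs : b s ≤ b x
        · left
          exact this.1.trans (Rmono.monotone (by omega))
        · right; omega
  obtain ⟨x, hx, y, hy, hxy⟩ := hnt
  obtain ⟨k, hk⟩ : ∃ k, b x = k := ⟨_, rfl⟩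
  have hloc : ∀ s ∈ S, b s = k := fun s hs => by
    have := hlocal' s hs x hx
    have := hlocal' x hx s hs
    omega
  have hinc : ∀ i : Fin n, e i ∉ S → (∀ s ∈ S, p s ≤ i.val ∧ i.val < q s) → False := by
    intro i hi h
    refine aux_cone hF hbounded.1 hS hi (fun s hs => ⟨?_, ?_⟩)
    · rw [heq]; have := h s hs; omega
    · rw [hep]; have := h s hs; omega
  have hqx := hqn x
  have hpqx := hpq x
  have hRk := Rlt k
  rcases hcol x with h | h | h | h
  · rw [hk] at h
    refine hinc ⟨R (k+1) - 1, by omega⟩ (fun hm => ?_) (fun s hs => ?_)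
    · have := hmono x hx _ hm
      rw [hcole] at this
      omega
    · have hs1 := hmono x hx s hs
      have hs2 := hloc s hs
      have hs3 := hb2 s
      rw [hs2] at hs3
      have hs4 : R (k+1) < q s := by
        have := hcol s
        rw [hs2] at this
        rcases this with h' | h' | h' | h' <;> omega
      simp only
      omega
  · rw [hk] at h
    refine hinc ⟨R (k+1) - 1, by omega⟩ (fun hm => ?_) (fun s hs => ?_)
    · have := hmono x hx _ hm
      rw [hcole] at this
      omega
    · have hs1 := hmono x hx s hs
      have hs2 := hloc s hs
      have hs3 := hb2 s
      rw [hs2] at hs3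
      have hs4 : q s = R (k+1) := by
        have := hcol s
        rw [hs2] at this
        rcases this with h' | h' | h' | h' <;> omega
      simp only
      omega
  · rw [hk] at h
    refine hinc ⟨R k, by omega⟩ (fun hm => ?_) (fun s hs => ?_)
    · have := hmono x hx _ hm
      rw [hcole] at this
      omega
    · have hs1 := hmono x hx s hs
      have hs2 := hloc s hs
      have hs3 := hpq s
      have hs4 : p s = R k := by
        have := hcol s
        rw [hs2] at this
        rcases this with h' | h' | h' | h' <;> omega
      simp only
      omega
  · rw [hk] at h
    have key : ∀ s ∈ S, (s ∈ Set.range e ∨ (q s < R (k + 1) ∧ R k < p s)) ∧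
        R k ≤ p s ∧ p s < R (k+1) := by
      intro s hs
      have hs1 := hmono x hx s hs
      have hs2 := hloc s hs
      have hs3 := hb2 s
      have hs4 := hb1 s
      rw [hs2] at hs3 hs4
      refine ⟨?_, hs4, hs3⟩
      have := hcol s
      rw [hs2] at this
      rcases this with h' | h' | h' | h'
      · omega
      · omega
      · omega
      · exact h'.2.1
    by_cases hsing : R (k+1) = R k + 1
    · have hall : ∀ s ∈ S, ∃ i, e i = s ∧ i.val = R k := by
        intro s hs
        obtain ⟨h1 | h1, h2, h3⟩ := key s hs
        · obtain ⟨i, rfl⟩ := h1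
          refine ⟨i, rfl, ?_⟩
          rw [pe] at h2 h3
          omega
        · omega
      obtain ⟨i, hi, hi'⟩ := hall x hx
      obtain ⟨j, hj, hj'⟩ := hall y hy
      apply hxy
      rw [← hi, ← hj]
      congr 1
      exact Fin.ext (hi'.trans hj'.symm)
    · obtain ⟨z, hz1, hz2⟩ := (Rx k).resolve_left hsing
      have hze : z ∉ Set.range e := by
        rintro ⟨i, rfl⟩
        rw [pe] at hz1
        rw [qe] at hz2
        omega
      have hzS : z ∉ S := by
        intro hzS
        obtain ⟨h1 | h1, h2, h3⟩ := key z hzS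
        · exact hze h1
        · omega
      refine aux_cone hF hbounded.1 hS hzS (fun s hs => ?_)
      obtain ⟨h1 | h1, h2, h3⟩ := key s hs
      · obtain ⟨i, rfl⟩ := h1
        rw [pe] at h2 h3
        rw [hep, heq]
        omega
      · refine ⟨fun hlt => ?_, fun hlt => ?_⟩
        · have := pm _ _ hlt; omega
        · have := qm _ _ hlt; omega
end

section
/- There exists a finite poset P with at least two elements such that for every colouring of the elements of P with 2 colours, some maximal antichain of P with at least two elements is monochromatic. -/
/-- `S` is a maximal antichain of the poset `P`: an antichain contained in no strictly larger
antichain of `P`. -/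
def IsMaxAntichainOf {P : Type*} [PartialOrder P] (S : Set P) : Prop :=
  IsAntichain (· ≤ ·) S ∧ ∀ T : Set P, IsAntichain (· ≤ ·) T → S ⊆ T → S = T

/-- `P` is a finite poset with at least two elements on which every 2-colouring leaves some
maximal antichain with at least two elements monochromatic. -/
def BadForMaxAntichains (P : Type*) [PartialOrder P] [Fintype P] : Prop :=
  1 < Fintype.card P ∧
    ∀ c : P → Fin 2, ∃ S : Set P, IsMaxAntichainOf S ∧ S.Nontrivial ∧
      ∀ x ∈ S, ∀ y ∈ S, c x = c y

/-- Row `i` is the bit mask of the up-set of `i`. -/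
def badRow : List ℕ :=
  [49825, 181922, 34436, 181951, 50869, 49824, 251647, 128, 251903, 640, 33920, 261815,
    251558, 255669, 49152, 32768, 247428, 181376]

def badLe (i j : Fin 18) : Bool := (badRow.getD i.val 0).testBit j.val

structure BadPt where
  val : Fin 18

@[reducible] def badOrder : PartialOrder BadPt where
  le a b := badLe a.val b.val = true
  le_refl a := by
    have h : ∀ i, badLe i i = true := by decide +kernel
    exact h _
  le_trans a b c := by
    have h : ∀ i j k, badLe i j = true → badLe j k = true → badLe i k = true := by
      decide +kernel
    exact h _ _ _
  le_antisymm a b h1 h2 := by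
    have h : ∀ i j, badLe i j = true → badLe j i = true → i = j := by decide +kernel
    have := h _ _ h1 h2
    cases a; cases b; simp_all

def badEquiv : BadPt ≃ Fin 18 := ⟨BadPt.val, BadPt.mk, fun _ => rfl, fun _ => rfl⟩

def badGood (l : List (Fin 18)) : Prop :=
  (∀ a ∈ l, ∀ b ∈ l, a ≠ b → badLe a b = false) ∧
    ∀ x, x ∉ l → ∃ a ∈ l, badLe a x = true ∨ badLe x a = true

instance (l : List (Fin 18)) : Decidable (badGood l) := by
  unfold badGood
  have : ∀ x, Decidable (∃ a ∈ l, badLe a x = true ∨ badLe x a = true) := fun x =>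
    decidable_of_iff (l.any (fun a => badLe a x || badLe x a) = true) (by simp)
  have : ∀ a, Decidable (∀ b ∈ l, a ≠ b → badLe a b = false) := fun a =>
    List.decidableBAll _ _
  have : Decidable (∀ a ∈ l, ∀ b ∈ l, a ≠ b → badLe a b = false) := List.decidableBAll _ _
  infer_instance

theorem bad_max (l : List (Fin 18)) (h : badGood l) :
    @IsMaxAntichainOf BadPt badOrder {p | p.val ∈ l} := by
  letI := badOrder
  refine ⟨?_, ?_⟩
  · intro a ha b hb hab hle
    have h1 := h.1 a.val ha b.val hb (fun e => hab (by cases a; cases b; simp_all))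
    have h2 : badLe a.val b.val = true := hle
    simp [h1] at h2
  · intro T hT hs
    refine Set.Subset.antisymm hs ?_
    intro x hx
    by_contra hn
    obtain ⟨a, ha, hax⟩ := h.2 x.val hn
    have haT : (⟨a⟩ : BadPt) ∈ T := hs ha
    have hne : (⟨a⟩ : BadPt) ≠ x := by
      rintro rfl
      exact hn ha
    rcases hax with hax | hax
    · exact hT haT hx hne hax
    · exact hT hx haT hne.symm hax

/-- There is a finite poset with at least two elements admitting no 2-colouring in which every
maximal antichain with at least two elements gets both colours. -/
theorem exists_bad_poset_for_two_colours :
    ∃ (P : Type) (instP : PartialOrder P) (instF : Fintype P),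
      @BadForMaxAntichains P instP instF := by
  refine ⟨BadPt, badOrder, Fintype.ofEquiv _ badEquiv.symm, ?_, ?_⟩
  · rw [Fintype.ofEquiv_card]; simp
  · intro c
    by_contra hcon
    push Not at hcon
    have key : ∀ a b : Fin 18, a ≠ b → badGood [a, b] → c ⟨a⟩ ≠ c ⟨b⟩ := by
      intro a b hab hg he
      obtain ⟨x, hx, y, hy, hxy⟩ := hcon _ (bad_max _ hg)
        ⟨⟨a⟩, by simp, ⟨b⟩, by simp, by simpa using hab⟩
      rcases x with ⟨x⟩
      rcases y with ⟨y⟩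
      simp only [Set.mem_setOf_eq, List.mem_cons, List.not_mem_nil, or_false] at hx hy
      rcases hx with rfl | rfl <;> rcases hy with rfl | rfl <;> simp_all
    have step : ∀ a b d : Fin 18, a ≠ b ∧ b ≠ d ∧ badGood [a, b] ∧ badGood [b, d] →
        c ⟨a⟩ = c ⟨d⟩ := by
      rintro a b d ⟨h1, h2, h3, h4⟩
      have := key a b h1 h3
      have := key b d h2 h4
      omega
    have e1 : c ⟨1⟩ = c ⟨0⟩ :=
      (step 1 13 6 (by decide +kernel)).trans <| (step 6 11 3 (by decide +kernel)).trans <|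
        (step 3 16 5 (by decide +kernel)).trans (step 5 10 0 (by decide +kernel))
    have e2 : c ⟨2⟩ = c ⟨0⟩ :=
      (step 2 14 7 (by decide +kernel)).trans <| (step 7 15 9 (by decide +kernel)).trans <|
        (step 9 17 4 (by decide +kernel)).trans (step 4 12 0 (by decide +kernel))
    obtain ⟨x, hx, y, hy, hxy⟩ := hcon _ (bad_max [0, 1, 2] (by decide +kernel))
        ⟨⟨0⟩, by simp, ⟨1⟩, by simp, by simp⟩
    rcases x with ⟨x⟩
    rcases y with ⟨y⟩
    simp only [Set.mem_setOf_eq, List.mem_cons, List.not_mem_nil, or_false] at hx hy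
    rcases hx with rfl | rfl | rfl <;> rcases hy with rfl | rfl | rfl <;> simp_all
end

section
/- Three colours suffice for maximal antichains: for every finite poset P with at least two elements there exists a colouring of the elements of P with 3 colours such that every maximal antichain of P with at least two elements gets at least two colours. -/
/-- The incomparability graph of a poset. -/
def incG (P : Type*) [PartialOrder P] : SimpleGraph P where
  Adj x y := ¬ x ≤ y ∧ ¬ y ≤ x
  symm := ⟨fun _ _ h => ⟨h.2, h.1⟩⟩
  loopless := ⟨fun _ h => h.1 le_rfl⟩

theorem incG_adj {P : Type*} [PartialOrder P] {x y : P} :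
    (incG P).Adj x y ↔ ¬ x ≤ y ∧ ¬ y ≤ x := Iff.rfl

theorem dist_adj_le {P : Type*} [PartialOrder P] {r x y : P} (hx : (incG P).Reachable r x)
    (h : (incG P).Adj x y) : (incG P).dist r y ≤ (incG P).dist r x + 1 := by
  obtain ⟨p, hp⟩ := hx.exists_walk_length_eq_dist
  have := SimpleGraph.dist_le (p.concat h)
  rw [SimpleGraph.Walk.length_concat, hp] at this
  exact this

theorem exists_pred {P : Type*} [PartialOrder P] {r x : P} {n : ℕ}
    (hx : (incG P).Reachable r x) (hn : (incG P).dist r x = n + 1) :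
    ∃ u, (incG P).Reachable r u ∧ (incG P).dist r u = n ∧ (incG P).Adj u x := by
  obtain ⟨p, hp⟩ := hx.symm.exists_walk_length_eq_dist
  rw [SimpleGraph.dist_comm, hn] at hp
  cases p with
  | nil => simp at hp
  | @cons _ u _ h q =>
    have hu : (incG P).Reachable r u := ⟨q.reverse⟩
    refine ⟨u, hu, ?_, h.symm⟩
    have h1 := dist_adj_le hu h.symm
    have h2 := SimpleGraph.dist_le q
    rw [SimpleGraph.dist_comm] at h2
    simp at hp
    omega

theorem dist_mono {P : Type*} [PartialOrder P] {r : P}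
    (hr : ∀ y, (incG P).Reachable r y → ¬ y < r) :
    ∀ (n : ℕ) (x y : P), (incG P).Reachable r x → (incG P).Reachable r y →
      (incG P).dist r x = n → y < x → (incG P).dist r y ≤ n := by
  intro n
  induction n with
  | zero =>
    intro x y hx hy hd hlt
    rw [hx.dist_eq_zero_iff] at hd
    subst hd
    exact absurd hlt (hr y hy)
  | succ n ih =>
    intro x y hx hy hd hlt
    obtain ⟨u, hu, hdu, hux⟩ := exists_pred hx hd
    by_cases h1 : y ≤ u
    · rcases h1.eq_or_lt with h | h
      · subst h; omega
      · have := ih u y hu hy hdu h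
        omega
    · have h2 : ¬ u ≤ y := fun h => hux.1 (h.trans hlt.le)
      have := dist_adj_le hu (show (incG P).Adj u y from ⟨h2, h1⟩)
      omega

/-- `z` is maximal in its distance layer. -/
def IsLayerTop {P : Type*} [PartialOrder P] (r z : P) (n : ℕ) : Prop :=
  (incG P).Reachable r z ∧ (incG P).dist r z = n ∧
    ∀ y, (incG P).Reachable r y → (incG P).dist r y = n → ¬ z < y

theorem exists_top {P : Type*} [PartialOrder P] [Finite P] {r x : P} {n : ℕ}
    (hx : (incG P).Reachable r x) (hn : (incG P).dist r x = n) :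
    ∃ z, x ≤ z ∧ IsLayerTop r z n := by
  obtain ⟨z, hz, hm⟩ := (Set.toFinite
    {z : P | (incG P).Reachable r z ∧ (incG P).dist r z = n}).exists_le_maximal
      (show x ∈ _ from ⟨hx, hn⟩)
  refine ⟨z, hz, hm.1.1, hm.1.2, fun y h1 h2 h3 => ?_⟩
  exact absurd (hm.2 (show y ∈ _ from ⟨h1, h2⟩) h3.le) h3.not_ge

theorem exists_path {P : Type*} [PartialOrder P] [Finite P] {r : P}
    (hr : ∀ y, (incG P).Reachable r y → ¬ y < r) :
    ∀ (n : ℕ) (z : P), IsLayerTop r z n → ∃ w : ℕ → P, w n = z ∧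
      (∀ i ≤ n, IsLayerTop r (w i) i) ∧ ∀ i < n, (incG P).Adj (w i) (w (i + 1)) := by
  intro n
  induction n with
  | zero =>
    intro z hz
    refine ⟨fun _ => z, rfl, ?_, ?_⟩
    · intro i hi
      obtain rfl : i = 0 := by omega
      exact hz
    · intro i hi; omega
  | succ n ih =>
    intro z hz
    obtain ⟨u, hu, hdu, huz⟩ := exists_pred hz.1 hz.2.1
    obtain ⟨v, huv, hv⟩ := exists_top hu hdu
    obtain ⟨w, hwn, hw1, hw2⟩ := ih v hv
    have hvz : (incG P).Adj v z := by
      refine ⟨fun h => huz.1 (huv.trans h), fun h => ?_⟩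
      rcases h.eq_or_lt with h | h
      · have h1 := hv.2.1
        have h2 := hz.2.1
        rw [h] at h2
        omega
      · have := dist_mono hr n v z hv.1 hz.1 hv.2.1 h
        have h2 := hz.2.1
        omega
    refine ⟨fun i => if i ≤ n then w i else z, by simp, ?_, ?_⟩
    · intro i hi
      by_cases h : i ≤ n
      · simpa [h] using hw1 i h
      · obtain rfl : i = n + 1 := by omega
        simpa using hz
    · intro i hi
      by_cases h : i < n
      · have h' : i + 1 ≤ n := h
        simpa [h.le, h'] using hw2 i h
      · obtain rfl : i = n := by omega
        simpa [hwn] using hvz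

theorem exists_dom {P : Type*} [PartialOrder P] [Finite P] {r : P}
    (hr : ∀ y, (incG P).Reachable r y → ¬ y < r) :
    ∃ w : ℕ → P, ∀ y, (incG P).Reachable r y →
      ((incG P).dist r y = 1 → (incG P).Adj y (w 0)) ∧
      ∀ j, (incG P).dist r y = j + 1 → (incG P).Adj y (w j) ∨ (incG P).Adj y (w (j + 1)) := by
  obtain ⟨x, hx, hmax⟩ := Set.exists_max_image {x : P | (incG P).Reachable r x}
    (fun x => (incG P).dist r x) (Set.toFinite _) ⟨r, SimpleGraph.Reachable.refl r⟩
  obtain ⟨z, -, hz⟩ := exists_top (show (incG P).Reachable r x from hx) rfl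
  obtain ⟨w, -, hw1, hw2⟩ := exists_path hr _ z hz
  refine ⟨w, fun y hy => ⟨fun h => ?_, fun j hj => ?_⟩⟩
  · have h0 := hw1 0 (Nat.zero_le _)
    have h1 : r = w 0 := h0.1.dist_eq_zero_iff.1 h0.2.1
    rw [← h1]
    exact (SimpleGraph.dist_eq_one_iff_adj.1 h).symm
  · have hjm : j + 1 ≤ (incG P).dist r x := hj ▸ hmax y hy
    have hwj := hw1 j (by omega)
    have hwj' := hw1 (j + 1) hjm
    have hadj := hw2 j (by omega)
    by_cases h : (incG P).Adj y (w j)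
    · exact Or.inl h
    right
    have hle : ¬ y ≤ w j := by
      intro h
      rcases h.eq_or_lt with h | h
      · have := hwj.2.1
        rw [← h] at this
        omega
      · have := dist_mono hr j _ _ hwj.1 hy hwj.2.1 h
        omega
    have hge : w j ≤ y := by
      by_contra h'
      exact h ⟨hle, h'⟩
    have h1 : ¬ y ≤ w (j + 1) := fun h => hadj.1 (hge.trans h)
    refine ⟨h1, fun h' => ?_⟩
    exact hwj'.2.2 y hy hj (lt_of_le_not_ge h' h1)

/-- The colour of a point, given its layer and whether it sees the previous centre. -/
def colr (j : ℕ) (b : Prop) [Decidable b] : Fin 3 :=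
  if b then ⟨(j + 2) % 3, by omega⟩ else ⟨j % 3, by omega⟩

theorem three_colours_suffice_for_maxAntichains
    (P : Type*) [PartialOrder P] [Fintype P] (hP : 1 < Fintype.card P) :
    ∃ c : P → Fin 3, ∀ S : Set P, IsMaxAntichainOf S → S.Nontrivial →
      ∃ x ∈ S, ∃ y ∈ S, c x ≠ c y := by
  classical
  have hroot : ∀ K : (incG P).ConnectedComponent, ∃ r : P,
      (incG P).connectedComponentMk r = K ∧ ∀ y, (incG P).Reachable r y → ¬ y < r := by
    intro K
    obtain ⟨x, hx⟩ := K.exists_rep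
    obtain ⟨r, -, hm⟩ := (Set.toFinite
      {z : P | (incG P).connectedComponentMk z = K}).exists_le_minimal (show x ∈ _ from hx)
    refine ⟨r, hm.1, fun y hy hlt => ?_⟩
    have : (incG P).connectedComponentMk y = K := by
      rw [← hm.1]
      exact SimpleGraph.ConnectedComponent.sound hy.symm
    exact absurd (hm.2 this hlt.le) hlt.not_ge
  choose root hr1 hr2 using hroot
  choose w hw using fun K => exists_dom (hr2 K)
  let k : P → (incG P).ConnectedComponent := (incG P).connectedComponentMk
  let d : P → ℕ := fun x => (incG P).dist (root (k x)) x
  refine ⟨fun x => colr (d x) (d x = 0 ∨ (incG P).Adj x (w (k x) (d x - 1))), ?_⟩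
  intro S hS hnt
  by_contra hcon
  push Not at hcon
  have hadj : ∀ a ∈ S, ∀ b ∈ S, a ≠ b → (incG P).Adj a b := fun a ha b hb hab =>
    ⟨hS.1 ha hb hab, hS.1 hb ha hab.symm⟩
  have hnodom : ∀ v : P, ¬ ∀ a ∈ S, (incG P).Adj a v := by
    intro v hv
    have hins : IsAntichain (· ≤ ·) (insert v S) := by
      intro a ha b hb hab
      rcases ha with rfl | ha <;> rcases hb with rfl | hb
      · exact absurd rfl hab
      · exact (hv b hb).2
      · exact (hv a ha).1
      · exact hS.1 ha hb hab
    have heq := hS.2 _ hins (Set.subset_insert v S)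
    have hvS : v ∈ S := by rw [heq]; exact Set.mem_insert v S
    exact (hv v hvS).1 le_rfl
  obtain ⟨x, hxS, hxmin⟩ := Set.exists_min_image S d (Set.toFinite _) hnt.nonempty
  have hk : ∀ a ∈ S, k a = k x := by
    intro a ha
    by_cases h : a = x
    · rw [h]
    · exact SimpleGraph.ConnectedComponent.sound (hadj a ha x hxS h).reachable
  have hreach : ∀ a ∈ S, (incG P).Reachable (root (k x)) a := by
    intro a ha
    rw [← hk a ha]
    exact SimpleGraph.ConnectedComponent.exact (hr1 (k a))
  have hd : ∀ a ∈ S, d a = (incG P).dist (root (k x)) a := by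
    intro a ha
    rw [← hk a ha]
  have hle : ∀ a ∈ S, d a = d x ∨ d a = d x + 1 := by
    intro a ha
    by_cases h : a = x
    · left; rw [h]
    · have h1 := dist_adj_le (hreach x hxS) (hadj x hxS a ha (Ne.symm h))
      rw [← hd a ha, ← hd x hxS] at h1
      have := hxmin a ha
      omega
  have hdom : ∀ a ∈ S, (d a = 1 → (incG P).Adj a (w (k x) 0)) ∧ ∀ j, d a = j + 1 →
      (incG P).Adj a (w (k x) j) ∨ (incG P).Adj a (w (k x) (j + 1)) := by
    intro a ha
    rw [hd a ha]
    exact hw (k x) a (hreach a ha)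
  have hcol : ∀ a ∈ S, colr (d a) (d a = 0 ∨ (incG P).Adj a (w (k x) (d a - 1))) =
      colr (d x) (d x = 0 ∨ (incG P).Adj x (w (k x) (d x - 1))) := by
    intro a ha
    have := hcon a ha x hxS
    simp only [hk a ha] at this
    exact this
  rcases Nat.eq_zero_or_pos (d x) with h0 | hpos
  · obtain ⟨a, ha, hax⟩ := hnt.exists_ne x
    have hda : d a = 1 := by
      rcases hle a ha with h | h
      · exfalso
        have h1 := hd a ha
        have h2 := hd x hxS
        rw [h, h0] at h1
        rw [h0] at h2
        have h3 := (hreach a ha).dist_eq_zero_iff.1 h1.symm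
        have h4 := (hreach x hxS).dist_eq_zero_iff.1 h2.symm
        exact hax (h3.symm.trans h4)
      · omega
    have h1 := hcol a ha
    have h2 := (hdom a ha).1 hda
    simp [colr, hda, h0, h2] at h1
  · obtain ⟨j, hj⟩ : ∃ j, d x = j + 1 := ⟨d x - 1, by omega⟩
    rw [hj] at hcol hle
    by_cases hx : (incG P).Adj x (w (k x) j)
    · apply hnodom (w (k x) j)
      intro a ha
      have h1 := hcol a ha
      by_contra hna
      rcases hle a ha with h | h
      · simp [colr, h, hx, hna] at h1
        omega
      · by_cases hb : (incG P).Adj a (w (k x) (j + 1))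
        · simp [colr, h, hx, hb] at h1
          omega
        · simp [colr, h, hx, hb] at h1
          omega
    · apply hnodom (w (k x) (j + 1))
      intro a ha
      have h1 := hcol a ha
      by_contra hna
      rcases hle a ha with h | h
      · have h2 := ((hdom a ha).2 j h).resolve_right hna
        simp [colr, h, hx, h2] at h1
        omega
      · simp [colr, h, hx, hna] at h1
        omega
end

section
/- Let F be a finite poset such that every maximal element of F has a lower cover in F which is not a minimal element of F. Let P be a finite poset and let a be an element of P such that every element of P strictly below a is a minimal element of P. If S is an F-free subset of P and no element of S is greater than or equal to a, then S ∪ {a} is also an F-free subset of P. -/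
/-- Suppose every maximal element of the finite poset `F` has a lower cover which is not
minimal. Let `a` be an element of a finite poset `P` such that every element strictly below `a`
is minimal in `P`. If `S` is an `F`-free subset of `P` none of whose elements is `≥ a`, then
`S ∪ {a}` is also `F`-free. -/
theorem freeOf_insert_height_one (F : Type*) [PartialOrder F] [Fintype F]
    (hcov : ∀ x : F, IsMax x → ∃ y : F, y ⋖ x ∧ ¬ IsMin y)
    (P : Type*) [PartialOrder P] [Fintype P] (a : P)
    (ha : ∀ y : P, y < a → IsMin y)
    (S : Set P) (hS : IsFreeOf F S) (hSa : ∀ x ∈ S, ¬ a ≤ x) :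
    IsFreeOf F (S ∪ {a}) := by
  rintro ⟨f, hf⟩
  by_cases h : ∃ x, f x = a
  · obtain ⟨x, hx⟩ := h
    have hmax : IsMax x := by
      intro y hxy
      have h1 : a ≤ f y := hx ▸ f.monotone hxy
      rcases hf ⟨y, rfl⟩ with h2 | h2
      · exact absurd h1 (hSa _ h2)
      · exact f.le_iff_le.1 (by rw [hx]; exact le_of_eq h2)
    obtain ⟨y, hy, hm⟩ := hcov x hmax
    refine hm fun z hz => ?_
    have h3 : f y < a := hx ▸ f.lt_iff_lt.2 hy.lt
    exact f.le_iff_le.1 (ha _ h3 (f.le_iff_le.2 hz))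
  · refine hS ⟨f, ?_⟩
    rintro _ ⟨y, rfl⟩
    rcases hf ⟨y, rfl⟩ with h2 | h2
    · exact h2
    · exact absurd ⟨y, h2⟩ h
end

section
/- Let n ≥ 3 and let F be the n-element antichain. For every positive integer k there exists a finite poset P with at least two elements such that for every colouring of the elements of P with k colours, some maximal F-free subset of P with at least two elements is monochromatic. (Hence χ_ac(F) does not exist.) -/
/-- The `n`-element antichain: `n` elements, any two distinct ones incomparable. -/
def FinAntichain (n : ℕ) : Type := Fin n

instance (n : ℕ) : PartialOrder (FinAntichain n) where
  le a b := a = b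
  le_refl _ := rfl
  le_trans _ _ _ h₁ h₂ := Eq.trans h₁ h₂
  le_antisymm _ _ h _ := h

/-- `P` is a finite poset with at least two elements on which every `k`-colouring leaves some
maximal `F`-free subset with at least two elements monochromatic. -/
def BadForFreeSets (F : Type*) [PartialOrder F] (k : ℕ)
    (P : Type*) [PartialOrder P] [Fintype P] : Prop :=
  1 < Fintype.card P ∧
    ∀ c : P → Fin k, ∃ S : Set P, IsMaxFreeOf F S ∧ S.Nontrivial ∧
      ∀ x ∈ S, ∀ y ∈ S, c x = c y

/-- For `n ≥ 3` and `F` the `n`-element antichain, no number `k` of colours suffices: there is a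
finite poset `P` with at least two elements such that every `k`-colouring of `P` leaves some
maximal `F`-free subset with at least two elements monochromatic. -/
theorem no_bound_for_antichain (n : ℕ) (hn : 3 ≤ n) (k : ℕ) (hk : 0 < k) :
    ∃ (P : Type) (instP : PartialOrder P) (instF : Fintype P),
      @BadForFreeSets (FinAntichain n) _ k P instP instF := by
  have hcard : Fintype.card (Fin (k * (n - 1))) = k * (n - 1) := Fintype.card_fin _
  have h2 : 2 ≤ n - 1 := by omega
  refine ⟨FinAntichain (k * (n - 1)), inferInstance,
    inferInstanceAs (Fintype (Fin (k * (n - 1)))), ?_, ?_⟩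
  · change 1 < Fintype.card (Fin (k * (n - 1)))
    rw [hcard]
    nlinarith
  · intro c
    let c' : Fin (k * (n - 1)) → Fin k := c
    haveI : Nonempty (Fin k) := ⟨⟨0, hk⟩⟩
    obtain ⟨y, hy⟩ := Fintype.exists_le_card_fiber_of_mul_le_card (f := c') (n := n - 1)
      (by simp)
    obtain ⟨t, hts, htc⟩ := Finset.exists_subset_card_eq hy
    let S : Set (Fin (k * (n - 1))) := ↑t
    refine ⟨S, ⟨?_, ?_⟩, ?_, ?_⟩
    · rintro ⟨f, hf⟩
      let g : Fin n → Fin (k * (n - 1)) := f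
      have hg : Function.Injective g := f.injective
      have hsub : Finset.univ.image g ⊆ t := by
        intro x hx
        obtain ⟨i, -, rfl⟩ := Finset.mem_image.1 hx
        exact hf ⟨i, rfl⟩
      have h := Finset.card_le_card hsub
      rw [Finset.card_image_of_injective _ hg, htc, Finset.card_univ, Fintype.card_fin] at h
      omega
    · intro T hT hfree
      obtain ⟨x, hxT, hxS⟩ := Set.exists_of_ssubset hT
      let x' : Fin (k * (n - 1)) := x
      have hx' : x' ∉ t := fun h => hxS h
      have hc : (insert x' t).card = n := by
        rw [Finset.card_insert_of_notMem hx', htc]; omega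
      let e := (insert x' t).equivFinOfCardEq hc
      let g : Fin n → Fin (k * (n - 1)) := fun i => (e.symm i).1
      have hg : Function.Injective g := fun a b h => e.symm.injective (Subtype.ext h)
      refine hfree ⟨⟨⟨g, hg⟩, ?_⟩, ?_⟩
      · intro a b
        exact ⟨fun h => hg h, fun h => congrArg g h⟩
      · rintro _ ⟨i, rfl⟩
        have hm : g i ∈ insert x' t := (e.symm i).2
        rcases Finset.mem_insert.1 hm with h | h
        · have h3 : g i ∈ (T : Set (Fin (k * (n - 1)))) := by rw [h]; exact hxT
          exact h3
        · exact hT.1 h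
    · obtain ⟨a, ha, b, hb, hab⟩ := Finset.one_lt_card.1 (show 1 < t.card by omega)
      exact ⟨a, ha, b, hb, hab⟩
    · intro a ha b hb
      have h1 := (Finset.mem_filter.1 (hts ha)).2
      have h2 := (Finset.mem_filter.1 (hts hb)).2
      exact h1.trans h2.symm
end

section
/- Let n ≥ 3 and let F be the n-element chain. For every positive integer k there exists a finite poset P with at least two elements such that for every colouring of the elements of P with k colours, some maximal F-free subset of P with at least two elements is monochromatic. (Hence χ_ac(F) does not exist.) -/
/-- For `n ≥ 3` and `F` the `n`-element chain (`Fin n` with its usual linear order), no number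
`k` of colours suffices: there is a finite poset `P` with at least two elements such that every
`k`-colouring of `P` leaves some maximal `F`-free subset with at least two elements
monochromatic. -/
theorem no_bound_for_chain (n : ℕ) (hn : 3 ≤ n) (k : ℕ) (hk : 0 < k) :
    ∃ (P : Type) (instP : PartialOrder P) (instF : Fintype P),
      @BadForFreeSets (Fin n) _ k P instP instF := by
  classical
  refine ⟨Fin (k * (n - 2) + 1), inferInstance, inferInstance, ?_, ?_⟩
  · rw [Fintype.card_fin]
    have : 0 < k * (n - 2) := Nat.mul_pos hk (by omega)
    omega
  intro c
  obtain ⟨y, hy⟩ := Fintype.exists_lt_card_fiber_of_mul_lt_card (n := n - 2) c (by simp)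
  obtain ⟨S, hS, hcard⟩ := Finset.exists_subset_card_eq
    (show n - 1 ≤ (Finset.univ.filter fun x => c x = y).card by omega)
  have hcol : ∀ x ∈ S, c x = y := fun x hx => (Finset.mem_filter.1 (hS hx)).2
  refine ⟨(S : Set _), ⟨?_, ?_⟩, ?_, ?_⟩
  · rintro ⟨f, hf⟩
    have h1 : (Finset.univ.map f.toEmbedding) ⊆ S := by
      intro x hx
      obtain ⟨a, _, rfl⟩ := Finset.mem_map.1 hx
      exact hf ⟨a, rfl⟩
    have h2 := Finset.card_le_card h1
    rw [Finset.card_map, Finset.card_univ, Fintype.card_fin] at h2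
    omega
  · intro T hT hfree
    have h1 : S ⊂ T.toFinset := by
      rw [← Finset.coe_ssubset]
      simpa using hT
    have h2 := Finset.card_lt_card h1
    apply hfree
    refine ⟨Finset.orderEmbOfCardLe T.toFinset (show n ≤ _ by omega), ?_⟩
    rintro _ ⟨a, rfl⟩
    exact Set.mem_toFinset.1 (Finset.orderEmbOfCardLe_mem _ _ a)
  · rw [Finset.nontrivial_coe, ← Finset.one_lt_card_iff_nontrivial]
    omega
  · intro x hx z hz
    rw [hcol x hx, hcol z hz]
end

section
/- Let F be the four-element poset that is the disjoint union of two two-element chains (elements a < b and c < d with no other comparabilities). Then two colours suffice for F: for every finite poset P with at least two elements there exists a colouring of the elements of P with 2 colours such that every maximal F-free subset of P having at least two elements gets both colours. -/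
theorem containsCopy_iff_aux {P : Type*} [PartialOrder P] (S : Set P) :
    ContainsCopy (Bool ⊕ Bool) S ↔ ∃ a ∈ S, ∃ b ∈ S, ∃ c ∈ S, ∃ d ∈ S,
      a < b ∧ c < d ∧ ¬ a ≤ d ∧ ¬ c ≤ b := by
  constructor
  · rintro ⟨f, hf⟩
    refine ⟨f (.inl false), hf ⟨_, rfl⟩, f (.inl true), hf ⟨_, rfl⟩,
      f (.inr false), hf ⟨_, rfl⟩, f (.inr true), hf ⟨_, rfl⟩, ?_, ?_, ?_, ?_⟩ <;> simp
  · rintro ⟨a, ha, b, hb, c, hc, d, hd, hab, hcd, had, hcb⟩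
    have h1 : ¬ b ≤ a := not_le_of_gt hab
    have h2 : ¬ d ≤ c := not_le_of_gt hcd
    have h3 : ¬ a ≤ c := fun h => had (h.trans hcd.le)
    have h4 : ¬ c ≤ a := fun h => hcb (h.trans hab.le)
    have h5 : ¬ b ≤ d := fun h => had (hab.le.trans h)
    have h6 : ¬ d ≤ b := fun h => hcb (hcd.le.trans h)
    have h7 : ¬ b ≤ c := fun h => h3 (hab.le.trans h)
    have h8 : ¬ d ≤ a := fun h => h4 (hcd.le.trans h)
    refine ⟨OrderEmbedding.ofMapLEIff
      (Sum.elim (fun x => cond x b a) (fun x => cond x d c)) ?_, ?_⟩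
    · rintro (_ | _) (_ | _) <;> rename_i x y <;> cases x <;> cases y <;>
        simp [*, hab.le, hcd.le]
    · rintro _ ⟨(_ | _), rfl⟩ <;> rename_i x <;> cases x <;> simpa

theorem exists_max_up_aux {P : Type*} [PartialOrder P] [Fintype P] (S : Set P)
    (hS : IsFreeOf (Bool ⊕ Bool) S) (hne : S.Nonempty) :
    ∃ m ∈ S, ∀ c ∈ S, ∀ d ∈ S, c < d → m ≤ d := by
  obtain ⟨m, hm, hmax⟩ := Set.exists_max_image S (fun m => (S ∩ Set.Ioi m).ncard)
    (Set.toFinite S) hne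
  refine ⟨m, hm, fun c hc d hd hcd => ?_⟩
  by_contra hmd
  have hex : ∃ e ∈ S, m < e ∧ ¬ c < e := by
    by_contra! h
    have : (S ∩ Set.Ioi m).ncard < (S ∩ Set.Ioi c).ncard := by
      apply Set.ncard_lt_ncard _ (Set.toFinite _)
      refine ⟨fun e he => ⟨he.1, h e he.1 he.2⟩, fun hsub => ?_⟩
      exact hmd (le_of_lt (hsub ⟨hd, hcd⟩).2)
    exact absurd (hmax c hc) (not_le_of_gt this)
  obtain ⟨e, he, hme, hce⟩ := hex
  refine hS ((containsCopy_iff_aux S).2 ⟨m, hm, e, he, c, hc, d, hd, hme, hcd, hmd, fun h => ?_⟩)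
  rcases h.lt_or_eq with h | rfl
  · exact hce h
  · exact hmd (hme.trans hcd).le

theorem mem_of_free_insert_aux {P : Type*} [PartialOrder P] {S : Set P}
    (hS : IsMaxFreeOf (Bool ⊕ Bool) S) (x : P)
    (h : IsFreeOf (Bool ⊕ Bool) (insert x S)) : x ∈ S := by
  by_contra hx
  exact hS.2 _ (Set.ssubset_insert hx) h

theorem exists_isMin_aux {P : Type*} [PartialOrder P] [Fintype P] (S : Set P)
    (hS : IsMaxFreeOf (Bool ⊕ Bool) S) (hne : S.Nonempty) : ∃ x ∈ S, IsMin x := by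
  obtain ⟨m, hm, hmax⟩ := exists_max_up_aux S hS.1 hne
  obtain ⟨x, hxm, hx⟩ := (Set.toFinite (Set.univ : Set P)).exists_le_minimal (Set.mem_univ m)
  have hx : IsMin x := by simpa using hx
  refine ⟨x, mem_of_free_insert_aux hS x ?_, hx⟩
  intro hc
  obtain ⟨a, ha, b, hb, c, hc, d, hd, hab, hcd, had, hcb⟩ := (containsCopy_iff_aux _).1 hc
  have hbS : b ∈ S := hb.resolve_left (fun h => hx.not_lt (h ▸ hab))
  have hdS : d ∈ S := hd.resolve_left (fun h => hx.not_lt (h ▸ hcd))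
  rcases ha with rfl | ha
  · rcases hc with rfl | hc
    · exact hcb hab.le
    · exact had (hxm.trans (hmax c hc d hdS hcd))
  · rcases hc with rfl | hc
    · exact hcb (hxm.trans (hmax a ha b hbS hab))
    · exact hS.1 ((containsCopy_iff_aux S).2
        ⟨a, ha, b, hbS, c, hc, d, hdS, hab, hcd, had, hcb⟩)

theorem exists_not_isMin_aux {P : Type*} [PartialOrder P] (S : Set P)
    (hS : IsMaxFreeOf (Bool ⊕ Bool) S) (p : P) (hp : ¬ IsMin p) : ∃ x ∈ S, ¬ IsMin x := by
  by_contra! h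
  refine hp (h p (mem_of_free_insert_aux hS p fun hc => ?_))
  obtain ⟨a, ha, b, hb, c, hc, d, hd, hab, hcd, had, hcb⟩ := (containsCopy_iff_aux _).1 hc
  have hbp : b = p := hb.resolve_right (fun h' => (h b h').not_lt hab)
  have hdp : d = p := hd.resolve_right (fun h' => (h d h').not_lt hcd)
  subst hbp
  exact had (hdp ▸ hab.le)

/-- For `F` the four-element poset which is the disjoint union of two two-element chains
(here `Bool ⊕ Bool` with the disjoint-union order: `inl false < inl true`,
`inr false < inr true`, and no comparabilities between the two summands), two colours suffice:
every finite poset `P` with at least two elements admits a 2-colouring such that every maximal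
`F`-free subset of `P` with at least two elements gets both colours. -/
theorem two_colours_suffice_twoPlusTwo
    (P : Type*) [PartialOrder P] [Fintype P] (hP : 1 < Fintype.card P) :
    ∃ c : P → Fin 2, ∀ S : Set P, IsMaxFreeOf (Bool ⊕ Bool) S → S.Nontrivial →
      ∃ x ∈ S, ∃ y ∈ S, c x ≠ c y := by
  classical
  by_cases hex : ∃ p : P, ¬ IsMin p
  · obtain ⟨p, hp⟩ := hex
    refine ⟨fun x => if IsMin x then 0 else 1, fun S hS hn => ?_⟩
    obtain ⟨x, hx, hx'⟩ := exists_isMin_aux S hS hn.nonempty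
    obtain ⟨y, hy, hy'⟩ := exists_not_isMin_aux S hS p hp
    exact ⟨x, hx, y, hy, by simp [hx', hy']⟩
  · push Not at hex
    obtain ⟨p, q, hpq⟩ := Fintype.one_lt_card_iff.1 hP
    refine ⟨fun x => if x = p then 0 else 1, fun S hS hn => ?_⟩
    have hall : ∀ x, x ∈ S := fun x => mem_of_free_insert_aux hS x fun hc => by
      obtain ⟨a, ha, b, hb, c, hc, d, hd, hab, hcd, had, hcb⟩ := (containsCopy_iff_aux _).1 hc
      exact (hex b).not_lt hab
    exact ⟨p, hall p, q, hall q, by simp [hpq.symm]⟩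
end

section
/- Let F be the three-element poset with one minimum element below two incomparable maximal elements (the 'V' poset: a < b, a < c, with b and c incomparable). Then: (1) for every finite poset P with at least two elements there exists a colouring of the elements of P with 3 colours such that every maximal F-free subset of P having at least two elements gets at least two colours; and (2) there exists a finite poset P with at least two elements such that for every colouring of P with 2 colours, some maximal F-free subset of P with at least two elements is monochromatic. In other words, χ_ac(F) = 3. -/
/-- The 'V' poset: one minimum element strictly below two incomparable maximal elements.
Here realised as `WithBot (Unit ⊕ Unit)`: the two elements `Sum.inl ()` and `Sum.inr ()` are
incomparable (the disjoint-union order on `Unit ⊕ Unit`), and `⊥` lies below both. -/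
abbrev VPoset : Type := WithBot (Unit ⊕ Unit)

theorem isFree_of_forall {P : Type*} [PartialOrder P] (S : Set P)
    (h : ∀ a ∈ S, ∀ b ∈ S, ∀ c ∈ S, a < b → a < c → ¬ b ≤ c → ¬ c ≤ b → False) :
    IsFreeOf VPoset S := by
  rintro ⟨f, hf⟩
  have m : ∀ v, f v ∈ S := fun v => hf ⟨v, rfl⟩
  refine h (f ⊥) (m _) (f ((Sum.inl () : Unit ⊕ Unit) : VPoset)) (m _)
    (f ((Sum.inr () : Unit ⊕ Unit) : VPoset)) (m _) ?_ ?_ ?_ ?_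
  · rw [f.lt_iff_lt]; exact WithBot.bot_lt_coe _
  · rw [f.lt_iff_lt]; exact WithBot.bot_lt_coe _
  · rw [f.le_iff_le, WithBot.coe_le_coe]; simp
  · rw [f.le_iff_le, WithBot.coe_le_coe]; simp

theorem free_no_V {P : Type*} [PartialOrder P] {S : Set P} (hS : IsFreeOf VPoset S)
    {a b c : P} (ha : a ∈ S) (hb : b ∈ S) (hc : c ∈ S) (hab : a < b) (hac : a < c)
    (hbc : ¬ b ≤ c) (hcb : ¬ c ≤ b) : False := by
  apply hS
  let g : VPoset → P := fun v => WithBot.recBotCoe a (fun s => Sum.elim (fun _ => b) (fun _ => c) s) v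
  refine ⟨OrderEmbedding.ofMapLEIff g ?_, ?_⟩
  · intro x y
    rcases x with _ | (⟨⟩ | ⟨⟩) <;> rcases y with _ | (⟨⟩ | ⟨⟩)
    · exact ⟨fun _ => le_rfl, fun _ => le_rfl⟩
    · exact ⟨fun _ => bot_le, fun _ => hab.le⟩
    · exact ⟨fun _ => bot_le, fun _ => hac.le⟩
    · exact ⟨fun h => absurd h hab.not_ge, fun h => absurd h (WithBot.bot_lt_coe _).not_ge⟩
    · exact ⟨fun _ => le_rfl, fun _ => le_rfl⟩
    · exact ⟨fun h => absurd h hbc, fun h => absurd (WithBot.coe_le_coe.1 h) (by simp)⟩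
    · exact ⟨fun h => absurd h hac.not_ge, fun h => absurd h (WithBot.bot_lt_coe _).not_ge⟩
    · exact ⟨fun h => absurd h hcb, fun h => absurd (WithBot.coe_le_coe.1 h) (by simp)⟩
    · exact ⟨fun _ => le_rfl, fun _ => le_rfl⟩
  · rintro _ ⟨x, rfl⟩
    rcases x with _ | (⟨⟩ | ⟨⟩)
    · exact ha
    · exact hb
    · exact hc

theorem part_one (P : Type*) [PartialOrder P] [Fintype P] (hP : 1 < Fintype.card P) :
    ∃ c : P → Fin 3, ∀ S : Set P, IsMaxFreeOf VPoset S → S.Nontrivial →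
        ∃ x ∈ S, ∃ y ∈ S, c x ≠ c y := by
  classical
  haveI : Nonempty P := Fintype.card_pos_iff.1 (by omega)
  obtain ⟨p, hp⟩ : ∃ p : P, IsMax p := by
    obtain ⟨p, hp⟩ := Set.finite_univ.exists_maximal (Set.univ_nonempty (α := P))
    exact ⟨p, fun b hb => hp.2 (Set.mem_univ b) hb⟩
  refine ⟨fun x => if x = p then 2 else if x < p then 0 else 1, ?_⟩
  intro S hS hn
  by_contra hcon
  push Not at hcon
  have hpS : p ∉ S := by
    intro h
    obtain ⟨q, hq, hqp⟩ := hn.exists_ne p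
    have := hcon p h q hq
    simp only [if_true, if_neg hqp] at this
    split_ifs at this <;> simp at this
  have key : (∀ x ∈ S, x < p) ∨ (∀ x ∈ S, ¬ x < p) := by
    by_contra hk
    push Not at hk
    obtain ⟨⟨x, hx, hxp⟩, y, hy, hyp⟩ := hk
    have hx' : x ≠ p := fun h => hpS (h ▸ hx)
    have hy' : y ≠ p := fun h => hpS (h ▸ hy)
    have := hcon x hx y hy
    simp [hx', hy', hxp, hyp] at this
  refine hS.2 (insert p S) (Set.ssubset_insert hpS) (isFree_of_forall _ ?_)
  intro a ha b hb c hc hab hac hbc hcb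
  have hap : a ≠ p := by rintro rfl; exact hp.not_lt hab
  have haS : a ∈ S := ha.resolve_left hap
  rcases key with k | k
  · rcases hb with rfl | hb
    · rcases hc with rfl | hc
      · exact hbc le_rfl
      · exact hcb (k c hc).le
    · rcases hc with rfl | hc
      · exact hbc (k b hb).le
      · exact free_no_V hS.1 haS hb hc hab hac hbc hcb
  · rcases hb with rfl | hb
    · exact k a haS hab
    · rcases hc with rfl | hc
      · exact k a haS hac
      · exact free_no_V hS.1 haS hb hc hab hac hbc hcb

theorem pair_max (S : Set VPoset) (u : VPoset) (hu : u ∉ S) (hS : ∀ v, v ≠ u → v ∈ S) :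
    IsMaxFreeOf VPoset S := by
  refine ⟨?_, ?_⟩
  · rintro ⟨f, hf⟩
    obtain ⟨v, hv⟩ := (Finite.injective_iff_surjective.1 f.injective) u
    exact hu (hf ⟨v, hv⟩)
  · intro T hT hfree
    obtain ⟨w, hw, hwS⟩ := Set.exists_of_ssubset hT
    have hwu : w = u := by
      by_contra h
      exact hwS (hS w h)
    apply hfree
    refine ⟨RelEmbedding.refl _, ?_⟩
    intro v _
    by_cases h : v = u
    · rw [h, ← hwu]; exact hw
    · exact hT.1 (hS v h)

theorem part_two (c : VPoset → Fin 2) : ∃ S : Set VPoset, IsMaxFreeOf VPoset S ∧ S.Nontrivial ∧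
        ∀ x ∈ S, ∀ y ∈ S, c x = c y := by
  let l : VPoset := ((Sum.inl () : Unit ⊕ Unit) : VPoset)
  let r : VPoset := ((Sum.inr () : Unit ⊕ Unit) : VPoset)
  have hl : (⊥ : VPoset) ≠ l := WithBot.bot_ne_coe
  have hr : (⊥ : VPoset) ≠ r := WithBot.bot_ne_coe
  have hlr : l ≠ r := fun h => by simpa using WithBot.coe_injective h
  have hall : ∀ v : VPoset, v = ⊥ ∨ v = l ∨ v = r := by
    rintro (_ | (⟨⟩ | ⟨⟩))
    · exact Or.inl rfl
    · exact Or.inr (Or.inl rfl)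
    · exact Or.inr (Or.inr rfl)
  have main : ∀ x y u : VPoset, x ≠ y → u ≠ x → u ≠ y → (∀ v, v = u ∨ v = x ∨ v = y) →
      c x = c y → ∃ S : Set VPoset, IsMaxFreeOf VPoset S ∧ S.Nontrivial ∧
        ∀ x ∈ S, ∀ y ∈ S, c x = c y := by
    intro x y u hxy hux huy hv hc
    refine ⟨{x, y}, pair_max _ u (by simp [hux, huy]) (fun v h => by
      simpa using (hv v).resolve_left h), ⟨x, by simp, y, by simp, hxy⟩, ?_⟩
    rintro a (rfl | rfl) b (rfl | rfl) <;> simp [hc]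
  by_cases h1 : c ⊥ = c l
  · exact main ⊥ l r hl hr.symm hlr.symm (fun v => by have := hall v; tauto) h1
  by_cases h2 : c ⊥ = c r
  · exact main ⊥ r l hr hl.symm hlr (fun v => by have := hall v; tauto) h2
  · exact main l r ⊥ hlr hl hr hall (by omega)

/-- For `F` the 'V' poset, `χ_ac(F) = 3`:
(1) every finite poset `P` with at least two elements admits a 3-colouring such that every
maximal `F`-free subset of `P` with at least two elements gets at least two colours, and
(2) there is a finite poset `P` with at least two elements on which every 2-colouring leaves
some maximal `F`-free subset with at least two elements monochromatic. -/
theorem chi_ac_V_eq_three :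
    (∀ (P : Type*) [PartialOrder P] [Fintype P], 1 < Fintype.card P →
      ∃ c : P → Fin 3, ∀ S : Set P, IsMaxFreeOf VPoset S → S.Nontrivial →
        ∃ x ∈ S, ∃ y ∈ S, c x ≠ c y) ∧
    (∃ (P : Type) (instP : PartialOrder P) (instF : Fintype P),
      1 < @Fintype.card P instF ∧
      ∀ c : P → Fin 2, ∃ S : Set P, @IsMaxFreeOf VPoset _ P instP S ∧ S.Nontrivial ∧
        ∀ x ∈ S, ∀ y ∈ S, c x = c y) := by
  refine ⟨fun P _ _ h => part_one P h, VPoset, inferInstance, inferInstance, by decide, part_two⟩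
end

section
/- Let F be the three-element poset consisting of a two-element chain together with one element incomparable to both (elements a < b, and c incomparable to a and to b). Then there exists a finite poset P with at least two elements such that for every colouring of the elements of P with 3 colours, some maximal F-free subset of P with at least two elements is monochromatic. In other words, χ_ac(F) ≥ 4. -/
/-- The three-element poset consisting of a two-element chain together with one element
incomparable to both. Here realised as `Bool ⊕ Unit` with the disjoint-union order:
`Sum.inl false < Sum.inl true` is the two-element chain and `Sum.inr ()` is incomparable
to both. -/
abbrev ChainPlusPoint : Type := Bool ⊕ Unit

/-- Any three distinct elements of `2 + 2` carry a copy of `2 + 1`. -/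
lemma three_copy (x y z : Bool ⊕ Bool) (hxy : x ≠ y) (hxz : x ≠ z) (hyz : y ≠ z) :
    ∃ g : ChainPlusPoint → Bool ⊕ Bool, (∀ a b, g a ≤ g b ↔ a ≤ b) ∧
      ∀ a, g a = x ∨ g a = y ∨ g a = z := by
  have key : ∀ x y z : Bool ⊕ Bool, x ≠ y → x ≠ z → y ≠ z →
      (∃ w, ∀ a : ChainPlusPoint, (Sum.elim Sum.inl (fun _ => Sum.inr w) a : Bool ⊕ Bool) = x ∨
        (Sum.elim Sum.inl (fun _ => Sum.inr w) a : Bool ⊕ Bool) = y ∨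
        (Sum.elim Sum.inl (fun _ => Sum.inr w) a : Bool ⊕ Bool) = z) ∨
      (∃ w, ∀ a : ChainPlusPoint, (Sum.elim Sum.inr (fun _ => Sum.inl w) a : Bool ⊕ Bool) = x ∨
        (Sum.elim Sum.inr (fun _ => Sum.inl w) a : Bool ⊕ Bool) = y ∨
        (Sum.elim Sum.inr (fun _ => Sum.inl w) a : Bool ⊕ Bool) = z) := by
    simp [Sum.forall, Bool.forall_bool, Bool.exists_bool]
  rcases key x y z hxy hxz hyz with ⟨w, h⟩ | ⟨w, h⟩
  · refine ⟨_, ?_, h⟩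
    rintro (a | a) (b | b) <;> simp
  · refine ⟨_, ?_, h⟩
    rintro (a | a) (b | b) <;> simp

lemma pair_max_s18 (x y : Bool ⊕ Bool) (hxy : x ≠ y) :
    IsMaxFreeOf ChainPlusPoint ({x, y} : Set (Bool ⊕ Bool)) := by
  constructor
  · rintro ⟨f, hf⟩
    have h1 := hf ⟨Sum.inl false, rfl⟩
    have h2 := hf ⟨Sum.inl true, rfl⟩
    have h3 := hf ⟨Sum.inr (), rfl⟩
    have n1 : f (Sum.inl false) ≠ f (Sum.inl true) := fun h => by simpa using f.injective h
    have n2 : f (Sum.inl false) ≠ f (Sum.inr ()) := fun h => by simpa using f.injective h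
    have n3 : f (Sum.inl true) ≠ f (Sum.inr ()) := fun h => by simpa using f.injective h
    simp only [Set.mem_insert_iff, Set.mem_singleton_iff] at h1 h2 h3
    grind
  · intro T hT hfree
    obtain ⟨hsub, z, hz, hzn⟩ := Set.ssubset_iff_exists.1 hT
    simp only [Set.mem_insert_iff, Set.mem_singleton_iff, not_or] at hzn
    obtain ⟨g, hg, hm⟩ := three_copy x y z hxy (Ne.symm hzn.1) (Ne.symm hzn.2)
    refine hfree ⟨OrderEmbedding.ofMapLEIff g hg, ?_⟩
    rintro _ ⟨a, rfl⟩
    have hx : x ∈ T := hsub (by simp)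
    have hy : y ∈ T := hsub (by simp)
    change g a ∈ T
    rcases hm a with h | h | h <;> rw [h] <;> assumption

/-- For `F` the two-element chain plus an incomparable point, `χ_ac(F) ≥ 4`: there is a finite
poset `P` with at least two elements on which every 3-colouring leaves some maximal `F`-free
subset with at least two elements monochromatic. -/
theorem chi_ac_chainPlusPoint_ge_four :
    ∃ (P : Type) (instP : PartialOrder P) (instF : Fintype P),
      1 < @Fintype.card P instF ∧
      ∀ c : P → Fin 3, ∃ S : Set P, @IsMaxFreeOf ChainPlusPoint _ P instP S ∧ S.Nontrivial ∧
        ∀ x ∈ S, ∀ y ∈ S, c x = c y := by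
  refine ⟨Bool ⊕ Bool, inferInstance, inferInstance, by decide, ?_⟩
  intro c
  obtain ⟨x, y, hxy, hc⟩ := Fintype.exists_ne_map_eq_of_card_lt c (by decide)
  refine ⟨{x, y}, pair_max_s18 x y hxy, Set.nontrivial_pair hxy, ?_⟩
  intro a ha b hb
  simp only [Set.mem_insert_iff, Set.mem_singleton_iff] at ha hb
  rcases ha with rfl | rfl <;> rcases hb with rfl | rfl <;> simp [hc]
end

section
/- Let F be the three-element poset with two incomparable minimal elements below one maximum element (the 'Λ' poset: b < a, c < a, with b and c incomparable). Then: (1) for every finite poset P with at least two elements there exists a colouring of the elements of P with 3 colours such that every maximal F-free subset of P having at least two elements gets at least two colours; and (2) there exists a finite poset P with at least two elements such that for every colouring of P with 2 colours, some maximal F-free subset of P with at least two elements is monochromatic. In other words, χ_ac(F) = 3. -/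
/-- The 'Λ' poset: two incomparable minimal elements strictly below one maximum element.
Here realised as `WithTop (Unit ⊕ Unit)`: the two elements `Sum.inl ()` and `Sum.inr ()` are
incomparable (the disjoint-union order on `Unit ⊕ Unit`), and `⊤` lies above both. -/
abbrev LambdaPoset : Type := WithTop (Unit ⊕ Unit)

theorem aux_minimal {P : Type*} [PartialOrder P] (m : P) (hm : ∀ x, ¬ x < m) (S : Set P)
    (hS : IsMaxFreeOf LambdaPoset S) (hmS : m ∉ S) :
    (∃ t ∈ S, m < t) ∧ (∃ d ∈ S, ¬ m ≤ d) := by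
  have h := hS.2 (insert m S) (Set.ssubset_insert hmS)
  have h' : ContainsCopy LambdaPoset (insert m S) := not_not.mp h
  obtain ⟨f, hf⟩ := h'
  have hfz : ∀ z, f z ≠ m → f z ∈ S := fun z hz =>
    (Set.mem_insert_iff.mp (hf ⟨z, rfl⟩)).resolve_left hz
  by_cases hr : ∃ z, f z = m
  · obtain ⟨z, rfl⟩ := hr
    have key : ∃ w : LambdaPoset, ¬ z ≤ w ∧ z < ⊤ := by
      induction z using WithTop.recTopCoe with
      | top =>
        exact absurd (f.lt_iff_lt.mpr (WithTop.coe_lt_top (Sum.inl ()))) (hm _)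
      | coe z =>
        rcases z with z | z
        · exact ⟨((Sum.inr () : Unit ⊕ Unit) : WithTop (Unit ⊕ Unit)), by simp, WithTop.coe_lt_top _⟩
        · exact ⟨((Sum.inl () : Unit ⊕ Unit) : WithTop (Unit ⊕ Unit)), by simp, WithTop.coe_lt_top _⟩
    obtain ⟨w, hw, ht⟩ := key
    have ht' : f z < f ⊤ := f.lt_iff_lt.mpr ht
    have hw' : ¬ f z ≤ f w := fun h => hw (f.le_iff_le.mp h)
    exact ⟨⟨f ⊤, hfz _ ht'.ne', ht'⟩, ⟨f w, hfz _ (fun h => hw' h.ge), hw'⟩⟩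
  · push Not at hr
    exact absurd ⟨f, by rintro _ ⟨z, rfl⟩; exact hfz z (hr z)⟩ hS.1

theorem aux_pair (x y : LambdaPoset) (hxy : x ≠ y) :
    IsMaxFreeOf LambdaPoset ({x, y} : Set LambdaPoset) := by
  have hc : Nat.card LambdaPoset = 3 := by
    rw [Nat.card_eq_fintype_card]; rfl
  constructor
  · rintro ⟨f, hf⟩
    have h1 := Set.ncard_le_ncard hf (Set.toFinite _)
    rw [Set.ncard_pair hxy, ← Set.image_univ, Set.ncard_image_of_injective _ f.injective,
      Set.ncard_univ, hc] at h1
    omega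
  · intro T hT hfree
    have h1 := Set.ncard_lt_ncard hT (Set.toFinite _)
    rw [Set.ncard_pair hxy] at h1
    have hu : T = Set.univ := by
      apply Set.eq_of_subset_of_ncard_le (Set.subset_univ _) _ (Set.toFinite _)
      rw [Set.ncard_univ, hc]; omega
    subst hu
    exact hfree ⟨RelEmbedding.refl _, Set.subset_univ _⟩

/-- For `F` the 'Λ' poset, `χ_ac(F) = 3`:
(1) every finite poset `P` with at least two elements admits a 3-colouring such that every
maximal `F`-free subset of `P` with at least two elements gets at least two colours, and
(2) there is a finite poset `P` with at least two elements on which every 2-colouring leaves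
some maximal `F`-free subset with at least two elements monochromatic. -/
theorem chi_ac_Lambda_eq_three :
    (∀ (P : Type*) [PartialOrder P] [Fintype P], 1 < Fintype.card P →
      ∃ c : P → Fin 3, ∀ S : Set P, IsMaxFreeOf LambdaPoset S → S.Nontrivial →
        ∃ x ∈ S, ∃ y ∈ S, c x ≠ c y) ∧
    (∃ (P : Type) (instP : PartialOrder P) (instF : Fintype P),
      1 < @Fintype.card P instF ∧
      ∀ c : P → Fin 2, ∃ S : Set P, @IsMaxFreeOf LambdaPoset _ P instP S ∧ S.Nontrivial ∧
        ∀ x ∈ S, ∀ y ∈ S, c x = c y) := by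
  classical
  refine ⟨?_, ?_⟩
  · intro P _ _ hP
    haveI : Nonempty P := Fintype.card_pos_iff.mp (by omega)
    obtain ⟨m, -, hm⟩ := (Set.finite_univ (α := P)).exists_minimal Set.univ_nonempty
    have hm' : ∀ x, ¬ x < m := fun x hx => hx.not_ge (hm (Set.mem_univ x) hx.le)
    refine ⟨fun x => if x = m then 0 else if m < x then 1 else 2, ?_⟩
    intro S hS hnt
    by_cases hmS : m ∈ S
    · obtain ⟨y, hy, hne⟩ := hnt.exists_ne m
      refine ⟨m, hmS, y, hy, ?_⟩
      simp only [if_true, hne, if_false]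
      split_ifs <;> decide
    · obtain ⟨⟨t, ht, hmt⟩, ⟨d, hd, hmd⟩⟩ := aux_minimal m hm' S hS hmS
      refine ⟨t, ht, d, hd, ?_⟩
      have h1 : d ≠ m := fun h => hmd h.ge
      have h2 : ¬ m < d := fun h => hmd h.le
      simp only [hmt.ne', hmt, h1, h2, if_true, if_false]
      decide
  · refine ⟨LambdaPoset, inferInstance, inferInstance, by decide, ?_⟩
    intro c
    obtain ⟨x, y, hxy, hc⟩ := Fintype.exists_ne_map_eq_of_card_lt c (by decide)
    refine ⟨{x, y}, aux_pair x y hxy, Set.nontrivial_pair hxy, ?_⟩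
    rintro a (rfl | rfl) b (rfl | rfl) <;> simp [hc]
end
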